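/- arXiv:1108.4246 — 3 statements merged into one kernel-verified Lean document; each statement's English description precedes it below -/
import Mathlib

section
/- For every dimension d ≥ 2, the function Φ_d(k) := ∫_{{|p| ≤ 1, |p−k| ≥ 1}} dp / ((1−|p|²)^{1/2}·(|p−k|²−1)^{1/2}) is bounded on ℝ^d, i.e., sup_{k ∈ ℝ^d} Φ_d(k) < ∞. -/
open MeasureTheory

lemma lint_right (a b α : ℝ) (hα : α < 1) (hab : a ≤ b) :
    ∫⁻ x in Set.Ioo a b, ENNReal.ofReal ((x - a) ^ (-α)) = ENNReal.ofReal ((b - a) ^ (1 - α) / (1 - α)) := by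
  have hi : IntervalIntegrable (fun x : ℝ => (x - a) ^ (-α)) volume a b := by
    have := (intervalIntegral.intervalIntegrable_rpow' (a := 0) (b := b - a) (r := -α) (by linarith)).comp_sub_right a
    simpa using this
  rw [restrict_Ioo_eq_restrict_Ioc, ← ofReal_integral_eq_lintegral_ofReal hi.1,
    ← intervalIntegral.integral_of_le hab]
  · congr 1
    rw [intervalIntegral.integral_comp_sub_right (fun x => x ^ (-α)) a, integral_rpow (Or.inl (by linarith))]
    rw [sub_self, Real.zero_rpow (by linarith)]
    ring_nf
  · filter_upwards [ae_restrict_mem measurableSet_Ioc] with y hy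
    exact Real.rpow_nonneg (by linarith [hy.1]) _

lemma lint_left (a b α : ℝ) (hα : α < 1) (hab : a ≤ b) :
    ∫⁻ x in Set.Ioo a b, ENNReal.ofReal ((b - x) ^ (-α)) = ENNReal.ofReal ((b - a) ^ (1 - α) / (1 - α)) := by
  have hi : IntervalIntegrable (fun x : ℝ => (b - x) ^ (-α)) volume a b := by
    have := (intervalIntegral.intervalIntegrable_rpow' (a := 0) (b := b - a) (r := -α) (by linarith)).comp_sub_left b
    simpa using this.symm
  rw [restrict_Ioo_eq_restrict_Ioc, ← ofReal_integral_eq_lintegral_ofReal hi.1,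
    ← intervalIntegral.integral_of_le hab]
  · congr 1
    rw [intervalIntegral.integral_comp_sub_left (fun x => x ^ (-α)) b, integral_rpow (Or.inl (by linarith))]
    rw [sub_self, Real.zero_rpow (by linarith)]
    ring_nf
  · filter_upwards [ae_restrict_mem measurableSet_Ioc] with y hy
    exact Real.rpow_nonneg (by linarith [hy.2]) _

lemma polar_bound {E : Type*} [NormedAddCommGroup E] [NormedSpace ℝ E] [MeasurableSpace E]
    [BorelSpace E] [FiniteDimensional ℝ E] [Nontrivial E] (μ : Measure E) [μ.IsAddHaarMeasure]
    (f : ℝ → ENNReal) (hf : Measurable f) :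
    ∫⁻ x, f ‖x‖ ∂μ = μ.toSphere Set.univ *
      ∫⁻ r in Set.Ioi (0:ℝ), ENNReal.ofReal (r ^ (Module.finrank ℝ E - 1)) * f r := by
  calc
    ∫⁻ x, f (‖x‖) ∂μ = ∫⁻ x : ({(0)}ᶜ : Set E), f (‖x.1‖) ∂(μ.comap (↑)) := by
      rw [lintegral_subtype_comap (measurableSet_singleton _).compl fun x ↦ f (‖x‖),
        restrict_compl_singleton]
    _ = ∫⁻ x, f x.2 ∂μ.toSphere.prod (.volumeIoiPow (Module.finrank ℝ E - 1)) := by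
      have := μ.measurePreserving_homeomorphUnitSphereProd.lintegral_comp_emb
        (Homeomorph.measurableEmbedding _) (f ∘ Subtype.val ∘ Prod.snd)
      simpa using this
    _ = μ.toSphere Set.univ * ∫⁻ x : Set.Ioi (0 : ℝ), f x ∂.volumeIoiPow (Module.finrank ℝ E - 1) := by
      rw [lintegral_prod _ (by fun_prop)]
      simp [mul_comm]
    _ = _ := by
      simp only [Measure.volumeIoiPow]
      rw [lintegral_withDensity_eq_lintegral_mul _ (by fun_prop) (by fun_prop)]
      rw [← lintegral_subtype_comap measurableSet_Ioi]
      rfl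

noncomputable def WW (A B : ℝ) : ENNReal :=
  if A ≤ 1 ∧ 1 ≤ B then ENNReal.ofReal (Real.sqrt (1 - A) * Real.sqrt (B - 1))⁻¹ else 0

lemma WW_meas : Measurable (fun q : ℝ × ℝ => WW q.1 q.2) := by
  unfold WW
  refine Measurable.ite ?_ (by fun_prop) measurable_const
  exact (measurableSet_le measurable_fst measurable_const).inter
    (measurableSet_le measurable_const measurable_snd)

lemma step1 {E : Type*} [NormedAddCommGroup E] [MeasurableSpace E] [BorelSpace E] (μ : Measure E) (k : E) :
   ENNReal.ofReal (∫ p in {p : E | ‖p‖ ≤ 1 ∧ 1 ≤ ‖p - k‖},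
        (Real.sqrt (1 - ‖p‖ ^ 2) * Real.sqrt (‖p - k‖ ^ 2 - 1))⁻¹ ∂μ) ≤
    ∫⁻ p, WW (‖p‖^2) (‖p-k‖^2) ∂μ := by
  have hS : MeasurableSet {p : E | ‖p‖ ≤ 1 ∧ 1 ≤ ‖p - k‖} := 
    ((isClosed_le continuous_norm continuous_const).inter
      (isClosed_le continuous_const (continuous_id.sub continuous_const).norm)).measurableSet
  refine (ENNReal.ofReal_le_ofReal (le_abs_self _)).trans ?_
  rw [← Real.norm_eq_abs, ofReal_norm]
  refine (enorm_integral_le_lintegral_enorm _).trans ?_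
  rw [← lintegral_indicator hS]
  refine lintegral_mono fun p => ?_
  unfold WW
  by_cases hp : p ∈ {p : E | ‖p‖ ≤ 1 ∧ 1 ≤ ‖p - k‖}
  · rw [Set.indicator_of_mem hp, if_pos, Real.enorm_of_nonneg (by positivity)]
    obtain ⟨h1, h2⟩ := hp
    constructor <;> nlinarith [norm_nonneg p]
  · rw [Set.indicator_of_notMem hp]; exact zero_le

lemma step2 {n : ℕ} (k : EuclideanSpace ℝ (Fin (n+1))) :
    ∫⁻ p, WW (‖p‖^2) (‖p-k‖^2) = 
    ∫⁻ p : EuclideanSpace ℝ (Fin (n+1)), WW (‖p‖^2) (‖p-EuclideanSpace.single 0 ‖k‖‖^2) := by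
  have h : ‖EuclideanSpace.single (0 : Fin (n+1)) ‖k‖‖ = ‖k‖ := by simp
  set e := EuclideanSpace.single (0 : Fin (n+1)) ‖k‖
  let R := (Submodule.span ℝ {e - k})ᗮ.reflection
  have hR : R e = k := Submodule.reflection_sub h
  rw [← R.measurePreserving.lintegral_comp_emb R.toHomeomorph.measurableEmbedding]
  refine lintegral_congr fun p => ?_
  rw [← hR, ← map_sub, R.norm_map, R.norm_map]

lemma step3 {n : ℕ} (s : ℝ) :
    ∫⁻ p : EuclideanSpace ℝ (Fin (n+1)), WW (‖p‖^2) (‖p-EuclideanSpace.single 0 s‖^2) = 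
    ∫⁻ y : EuclideanSpace ℝ (Fin n), ∫⁻ x : ℝ, WW (x^2+‖y‖^2) ((x-s)^2+‖y‖^2) := by
  have hm : Measurable fun q : ℝ × EuclideanSpace ℝ (Fin n) => WW (q.1^2+‖q.2‖^2) ((q.1-s)^2+‖q.2‖^2) :=
    WW_meas.comp (f := fun q : ℝ × EuclideanSpace ℝ (Fin n) => (q.1^2+‖q.2‖^2, (q.1-s)^2+‖q.2‖^2)) (by fun_prop)
  rw [← lintegral_prod_symm _ hm.aemeasurable]
  have h1 := (EuclideanSpace.volume_preserving_symm_measurableEquiv_toLp (Fin (n+1)))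
  have h2 := (volume_preserving_piFinSuccAbove (fun _ : Fin (n + 1) => ℝ) 0)
  have h3 : MeasurePreserving (Prod.map id (@WithLp.toLp 2 (Fin n → ℝ)) : ℝ × (Fin n → ℝ) → ℝ × EuclideanSpace ℝ (Fin n)) volume volume :=
    (MeasurePreserving.id volume).prod (PiLp.volume_preserving_toLp (Fin n))
  have h4 := h3.comp (h2.comp h1)
  change _ = ∫⁻ q : ℝ × EuclideanSpace ℝ (Fin n), WW (q.1^2+‖q.2‖^2) ((q.1-s)^2+‖q.2‖^2) ∂volume
  rw [← h4.lintegral_comp hm]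
  refine lintegral_congr fun p => ?_
  simp only [EuclideanSpace.real_norm_sq_eq, Fin.sum_univ_succ]
  simp [MeasurableEquiv.piFinSuccAbove, Fin.insertNthEquiv, Fin.tail]

lemma pt_bound (m M u : ℝ) (hm : 0 < m) (hM : m < M) (h0 : 0 < u) (hu : u < m) :
    (Real.sqrt (u * (m - u) * (M - u) * (M + m - u)))⁻¹ ≤
      M ^ (-(3/4) : ℝ) * (M - m) ^ (-(1/4) : ℝ) *
        (2 * m ^ (-(1/2) : ℝ) * u ^ (-(1/2) : ℝ) + 2 * m ^ (-(1/4) : ℝ) * (m - u) ^ (-(3/4) : ℝ)) := by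
  have h1 : 0 < m - u := by linarith
  have h2 : 0 < M - u := by linarith
  have h3 : 0 < M + m - u := by linarith
  have h4 : 0 < M := by linarith
  have h5 : 0 < M - m := by linarith
  set P := u * (m - u) * (M - u) * (M + m - u) with hP
  have hPpos : 0 < P := by positivity
  have e1 : (Real.sqrt P)⁻¹ = (P ^ 2) ^ (-(1/4) : ℝ) := by
    rw [Real.sqrt_eq_rpow, ← Real.rpow_neg hPpos.le, ← Real.rpow_natCast, ← Real.rpow_mul hPpos.le]
    norm_num
  have key : M ^ 3 * (M - m) * m⁻¹ * u ^ 2 * (m - u) ^ 3 ≤ P ^ 2 := by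
    have a1 : M ^ 2 ≤ (M + m - u) ^ 2 := by gcongr; linarith
    have a2 : (M - m) * (M * m⁻¹ * (m - u)) ≤ (M - u) * (M - u) := by
      refine mul_le_mul (by linarith) ?_ (by positivity) h2.le
      have : M * m⁻¹ * (m - u) = M - M * u / m := by field_simp
      rw [this]
      have : u ≤ M * u / m := by rw [le_div_iff₀ hm]; nlinarith
      linarith
    calc M ^ 3 * (M - m) * m⁻¹ * u ^ 2 * (m - u) ^ 3
        = (u^2 * (m-u)^2) * (((M - m) * (M * m⁻¹ * (m - u))) * M^2) := by ring
      _ ≤ (u^2 * (m-u)^2) * (((M - u) * (M - u)) * (M + m - u)^2) := by gcongr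
      _ = P ^ 2 := by rw [hP]; ring
  have e2 : (M ^ 3 * (M - m) * m⁻¹ * u ^ 2 * (m - u) ^ 3) ^ (-(1/4) : ℝ) =
      M ^ (-(3/4) : ℝ) * (M - m) ^ (-(1/4) : ℝ) * (m ^ (1/4 : ℝ) * u ^ (-(1/2) : ℝ) * (m - u) ^ (-(3/4) : ℝ)) := by
    rw [Real.mul_rpow (by positivity) (by positivity), Real.mul_rpow (by positivity) (by positivity),
      Real.mul_rpow (by positivity) (by positivity), Real.mul_rpow (by positivity) (by positivity),
      ← Real.rpow_natCast M, ← Real.rpow_natCast u, ← Real.rpow_natCast (m - u),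
      ← Real.rpow_mul h4.le, ← Real.rpow_mul h0.le, ← Real.rpow_mul h1.le,
      ← Real.rpow_neg_one m, ← Real.rpow_mul hm.le]
    norm_num
    ring
  rw [e1]
  refine (Real.rpow_le_rpow_of_nonpos (by positivity) key (by norm_num)).trans ?_
  rw [e2]
  gcongr
  have two1 : ((1:ℝ)/2) ^ (-(3/4) : ℝ) ≤ 2 := by
    calc ((1:ℝ)/2) ^ (-(3/4) : ℝ) ≤ ((1:ℝ)/2) ^ (-1 : ℝ) :=
          Real.rpow_le_rpow_of_exponent_ge (by norm_num) (by norm_num) (by norm_num)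
      _ = 2 := by rw [Real.rpow_neg_one]; norm_num
  have two2 : ((1:ℝ)/2) ^ (-(1/2) : ℝ) ≤ 2 := by
    calc ((1:ℝ)/2) ^ (-(1/2) : ℝ) ≤ ((1:ℝ)/2) ^ (-1 : ℝ) :=
          Real.rpow_le_rpow_of_exponent_ge (by norm_num) (by norm_num) (by norm_num)
      _ = 2 := by rw [Real.rpow_neg_one]; norm_num
  rcases le_total u (m/2) with hh | hh
  · have b1 : (m - u) ^ (-(3/4) : ℝ) ≤ 2 * m ^ (-(3/4) : ℝ) := by
      calc (m - u) ^ (-(3/4) : ℝ) ≤ (1/2 * m) ^ (-(3/4) : ℝ) :=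
            Real.rpow_le_rpow_of_nonpos (by positivity) (by linarith) (by norm_num)
        _ = (1/2) ^ (-(3/4) : ℝ) * m ^ (-(3/4) : ℝ) := Real.mul_rpow (by norm_num) hm.le
        _ ≤ _ := by gcongr
    have b2 : m ^ (1/4 : ℝ) * m ^ (-(3/4) : ℝ) = m ^ (-(1/2) : ℝ) := by
      rw [← Real.rpow_add hm]; norm_num
    calc m ^ (1/4 : ℝ) * u ^ (-(1/2) : ℝ) * (m - u) ^ (-(3/4) : ℝ)
        ≤ m ^ (1/4 : ℝ) * u ^ (-(1/2) : ℝ) * (2 * m ^ (-(3/4) : ℝ)) := by gcongr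
      _ = 2 * (m ^ (1/4 : ℝ) * m ^ (-(3/4) : ℝ)) * u ^ (-(1/2) : ℝ) := by ring
      _ = 2 * m ^ (-(1/2) : ℝ) * u ^ (-(1/2) : ℝ) := by rw [b2]
      _ ≤ _ := le_add_of_nonneg_right (by positivity)
  · have b1 : u ^ (-(1/2) : ℝ) ≤ 2 * m ^ (-(1/2) : ℝ) := by
      calc u ^ (-(1/2) : ℝ) ≤ (1/2 * m) ^ (-(1/2) : ℝ) :=
            Real.rpow_le_rpow_of_nonpos (by positivity) (by linarith) (by norm_num)
        _ = (1/2) ^ (-(1/2) : ℝ) * m ^ (-(1/2) : ℝ) := Real.mul_rpow (by norm_num) hm.le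
        _ ≤ _ := by gcongr
    have b2 : m ^ (1/4 : ℝ) * m ^ (-(1/2) : ℝ) = m ^ (-(1/4) : ℝ) := by
      rw [← Real.rpow_add hm]; norm_num
    calc m ^ (1/4 : ℝ) * u ^ (-(1/2) : ℝ) * (m - u) ^ (-(3/4) : ℝ)
        ≤ m ^ (1/4 : ℝ) * (2 * m ^ (-(1/2) : ℝ)) * (m - u) ^ (-(3/4) : ℝ) := by gcongr
      _ = 2 * (m ^ (1/4 : ℝ) * m ^ (-(1/2) : ℝ)) * (m - u) ^ (-(3/4) : ℝ) := by ring
      _ = 2 * m ^ (-(1/4) : ℝ) * (m - u) ^ (-(3/4) : ℝ) := by rw [b2]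
      _ ≤ _ := le_add_of_nonneg_left (by positivity)

/-- integral over the segment of the pointwise bound -/
lemma seg_int (m c h : ℝ) (hm : 0 < m) (hc : 0 ≤ c) :
    ∫⁻ x in Set.Ioo (-h) (m - h), ENNReal.ofReal (c *
        (2 * m ^ (-(1/2) : ℝ) * (h + x) ^ (-(1/2) : ℝ) + 2 * m ^ (-(1/4) : ℝ) * (m - (h + x)) ^ (-(3/4) : ℝ)))
      ≤ ENNReal.ofReal (12 * c) := by
  have r := lint_right (-h) (m - h) (1/2) (by norm_num) (by linarith)
  have l := lint_left (-h) (m - h) (3/4) (by norm_num) (by linarith)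
  calc _ = ∫⁻ x in Set.Ioo (-h) (m - h), (ENNReal.ofReal (c * (2 * m ^ (-(1/2) : ℝ))) * ENNReal.ofReal ((x - -h) ^ (-(1/2) : ℝ))
        + ENNReal.ofReal (c * (2 * m ^ (-(1/4) : ℝ))) * ENNReal.ofReal ((m - h - x) ^ (-(3/4) : ℝ))) := by
        refine setLIntegral_congr_fun measurableSet_Ioo fun x hx => ?_
        have q1 : 0 < x - -h := by linarith [hx.1]
        have q2 : 0 < m - h - x := by linarith [hx.2]
        rw [← ENNReal.ofReal_mul (by positivity), ← ENNReal.ofReal_mul (by positivity),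
          ← ENNReal.ofReal_add (by positivity) (by positivity)]
        congr 1
        rw [show h + x = x - -h by ring, show m - (x - -h) = m - h - x by ring]
        ring
    _ = ENNReal.ofReal (12 * c) := by
        rw [lintegral_add_left (by fun_prop), lintegral_const_mul _ (by fun_prop),
          lintegral_const_mul _ (by fun_prop), r, l, ← ENNReal.ofReal_mul (by positivity),
          ← ENNReal.ofReal_mul (by positivity), ← ENNReal.ofReal_add]
        · congr 1
          rw [show m - h - -h = m by ring]
          have t1 : m ^ (-(1/2) : ℝ) * m ^ (1 - 1/2 : ℝ) = 1 := by
            rw [← Real.rpow_add hm]; norm_num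
          have t2 : m ^ (-(1/4) : ℝ) * m ^ (1 - 3/4 : ℝ) = 1 := by
            rw [← Real.rpow_add hm]; norm_num
          calc _ = 4 * c * (m ^ (-(1/2) : ℝ) * m ^ (1 - 1/2 : ℝ)) + 8 * c * (m ^ (-(1/4) : ℝ) * m ^ (1 - 3/4 : ℝ)) := by ring
            _ = _ := by rw [t1, t2]; ring
        · rw [show m - h - -h = m by ring]; norm_num; positivity
        · rw [show m - h - -h = m by ring]; norm_num; positivity
    _ ≤ _ := le_rfl

lemma inner_bound (r s h : ℝ) (hh : 0 < h) (hs : 0 < s) (hne : s ≠ 2 * h) (hr : h ^ 2 = 1 - r ^ 2) :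
    ∫⁻ x : ℝ, WW (x^2+r^2) ((x-s)^2+r^2) ≤
      ENNReal.ofReal (12 * ((2 * h) ^ (-(3/4) : ℝ) * |2 * h - s| ^ (-(1/4) : ℝ))) := by
  obtain ⟨m, M, hm, hmM, hM, hd, hs', ha⟩ : ∃ m M : ℝ, 0 < m ∧ m < M ∧ 2 * h ≤ M ∧ M - m = |2 * h - s| ∧
      (∀ u, (2 * h - u) * (s - u) * (2 * h + s - u) = (m - u) * (M - u) * (M + m - u)) ∧
      (∀ u, u < 2 * h → u < s → u < m) := by
    rcases lt_or_gt_of_ne hne with H | H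
    · refine ⟨s, 2 * h, hs, H, le_rfl, ?_, fun u => by ring, fun u _ h => h⟩
      rw [abs_of_pos (by linarith)]
    · refine ⟨2 * h, s, by linarith, H, H.le, ?_, fun u => by ring, fun u h _ => h⟩
      rw [abs_of_neg (by linarith)]; ring
  have hMm : 0 < M - m := by linarith
  have hM0 : 0 < M := by linarith
  have step : ∀ x : ℝ, WW (x^2+r^2) ((x-s)^2+r^2) ≤ (Set.Ioo (-h) (m - h)).indicator
      (fun x => ENNReal.ofReal ((M ^ (-(3/4) : ℝ) * (M - m) ^ (-(1/4) : ℝ)) *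
        (2 * m ^ (-(1/2) : ℝ) * (h + x) ^ (-(1/2) : ℝ) + 2 * m ^ (-(1/4) : ℝ) * (m - (h + x)) ^ (-(3/4) : ℝ)))) x := by
    intro x
    unfold WW
    split_ifs with hx
    swap
    · exact zero_le
    obtain ⟨hx1, hx2⟩ := hx
    have c1 : 0 ≤ 1 - (x^2+r^2) := by linarith
    have c2 : 0 ≤ (x-s)^2+r^2 - 1 := by linarith
    rcases c1.eq_or_lt with c1 | c1
    · simp [← c1]
    rcases c2.eq_or_lt with c2 | c2
    · simp [← c2]
    have d1 : x ^ 2 < h ^ 2 := by linarith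
    have d2 : h ^ 2 < (x - s) ^ 2 := by linarith
    obtain ⟨d3, d4⟩ := abs_lt_of_sq_lt_sq' d1 hh.le
    have d5 : h + x < s := by
      by_contra hcon
      push Not at hcon
      nlinarith
    have d6 : h + x < m := ha _ (by linarith) d5
    rw [Set.indicator_of_mem (by constructor <;> linarith)]
    refine ENNReal.ofReal_le_ofReal ?_
    have := pt_bound m M (h + x) hm hmM (by linarith) d6
    refine le_trans (le_of_eq ?_) this
    rw [← Real.sqrt_mul c1.le]
    congr 2
    have e := hs' (h + x)
    have : (1 - (x^2+r^2)) * ((x-s)^2+r^2 - 1) = (h^2 - x^2) * ((x-s)^2 - h^2) := by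
      rw [hr]; ring
    rw [this]
    linear_combination (h + x) * e
  refine (lintegral_mono step).trans ?_
  rw [lintegral_indicator measurableSet_Ioo]
  refine (seg_int m _ h hm (by positivity)).trans ?_
  refine ENNReal.ofReal_le_ofReal ?_
  rw [hd]
  gcongr 12 * (?_ * _)
  exact Real.rpow_le_rpow_of_nonpos (by linarith) hM (by norm_num)

lemma young_aux (A B : ℝ) (hA : 0 < A) (hB : 0 < B) :
    A ^ (-(3/8) : ℝ) * B ^ (-(1/2) : ℝ) ≤ A ^ (-(7/8) : ℝ) + B ^ (-(7/8) : ℝ) := by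
  rcases le_total A B with h | h
  · calc A ^ (-(3/8) : ℝ) * B ^ (-(1/2) : ℝ) ≤ A ^ (-(3/8) : ℝ) * A ^ (-(1/2) : ℝ) := by
          gcongr ?_ * ?_
          exact Real.rpow_le_rpow_of_nonpos hA h (by norm_num)
      _ = A ^ (-(7/8) : ℝ) := by rw [← Real.rpow_add hA]; norm_num
      _ ≤ _ := le_add_of_nonneg_right (by positivity)
  · calc A ^ (-(3/8) : ℝ) * B ^ (-(1/2) : ℝ) ≤ B ^ (-(3/8) : ℝ) * B ^ (-(1/2) : ℝ) := by
          gcongr ?_ * ?_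
          exact Real.rpow_le_rpow_of_nonpos hB h (by norm_num)
      _ = B ^ (-(7/8) : ℝ) := by rw [← Real.rpow_add hB]; norm_num
      _ ≤ _ := le_add_of_nonneg_left (by positivity)

lemma dist_aux (r h s : ℝ) (hr0 : 0 ≤ r) (hh : 0 < h) (hs : 0 < s) (hr : h ^ 2 = 1 - r ^ 2) :
    |Real.sqrt (1 - (s/2)^2) - r| ^ 2 ≤ |2 * h - s| := by
  have h1 : h ≤ 1 := by nlinarith
  rw [sq_abs]
  rcases le_total 2 s with H | H
  · rw [Real.sqrt_eq_zero_of_nonpos (by nlinarith), abs_of_nonpos (by linarith)]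
    nlinarith
  · set ρ := Real.sqrt (1 - (s/2)^2) with hρ
    have hρ0 : 0 ≤ ρ := Real.sqrt_nonneg _
    have hρ2 : ρ ^ 2 = 1 - (s/2)^2 := Real.sq_sqrt (by nlinarith)
    have e : (ρ - r) * (ρ + r) = (2 * h - s) * ((2 * h + s) / 4) := by
      linear_combination hρ2 - hr
    have f0 : (ρ - r) ^ 2 ≤ |(ρ - r) * (ρ + r)| := by
      rw [abs_mul, abs_of_nonneg (a := ρ + r) (by linarith), ← sq_abs, sq]
      gcongr
      exact abs_le.2 ⟨by linarith, by linarith⟩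
    rw [e, abs_mul, abs_of_nonneg (a := (2 * h + s) / 4) (by linarith)] at f0
    refine f0.trans (mul_le_of_le_one_right (abs_nonneg _) (by linarith))

noncomputable def GG (ρ r : ℝ) : ENNReal :=
  (Set.Iic (1:ℝ)).indicator (fun r => 12 * (ENNReal.ofReal (1 - r) ^ (-(7/8) : ℝ) +
    ENNReal.ofReal |ρ - r| ^ (-(7/8) : ℝ))) r

lemma GG_meas (ρ : ℝ) : Measurable (GG ρ) := by
  unfold GG
  refine Measurable.indicator ?_ measurableSet_Iic
  fun_prop

lemma inner_GG (r s : ℝ) (hr0 : 0 ≤ r) (hs : 0 < s) :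
    ∫⁻ x : ℝ, WW (x^2+r^2) ((x-s)^2+r^2) ≤ GG (Real.sqrt (1 - (s/2)^2)) r := by
  rcases lt_trichotomy r 1 with h | h | h
  · set ρ := Real.sqrt (1 - (s/2)^2) with hρ
    unfold GG
    rw [Set.indicator_of_mem (show r ∈ Set.Iic (1:ℝ) from h.le)]
    by_cases hρr : ρ = r
    · rw [hρr, sub_self, abs_zero, ENNReal.ofReal_zero, ENNReal.zero_rpow_of_neg (by norm_num)]
      simp
    have hpos : 0 < 1 - r ^ 2 := by nlinarith
    have hh : 0 < Real.sqrt (1 - r ^ 2) := Real.sqrt_pos.2 hpos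
    have hh2 := Real.sq_sqrt hpos.le
    set h' := Real.sqrt (1 - r ^ 2) with hh'
    have hd := dist_aux r h' s hr0 hh hs hh2
    rw [← hρ] at hd
    have hab : 0 < |ρ - r| := abs_pos.2 (sub_ne_zero.2 hρr)
    have hne : s ≠ 2 * h' := by
      intro hc
      rw [hc, sub_self, abs_zero] at hd
      nlinarith
    refine (inner_bound r s h' hh hs hne hh2).trans ?_
    have h1r : 0 < 1 - r := by linarith
    rw [ENNReal.ofReal_rpow_of_pos h1r, ENNReal.ofReal_rpow_of_pos hab,
      ← ENNReal.ofReal_add (by positivity) (by positivity),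
      show (12 : ENNReal) = ENNReal.ofReal 12 by norm_num, ← ENNReal.ofReal_mul (by norm_num)]
    refine ENNReal.ofReal_le_ofReal ?_
    gcongr 12 * ?_
    refine le_trans ?_ (young_aux _ _ h1r hab)
    gcongr ?_ * ?_
    · calc (2 * h') ^ (-(3/4) : ℝ) ≤ (Real.sqrt (1 - r)) ^ (-(3/4) : ℝ) := by
            refine Real.rpow_le_rpow_of_nonpos (Real.sqrt_pos.2 h1r) ?_ (by norm_num)
            have : Real.sqrt (1 - r) ≤ h' := Real.sqrt_le_sqrt (by nlinarith)
            linarith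
        _ = (1 - r) ^ (-(3/8) : ℝ) := by
            rw [Real.sqrt_eq_rpow, ← Real.rpow_mul h1r.le]; norm_num
    · calc |2 * h' - s| ^ (-(1/4) : ℝ) ≤ (|ρ - r| ^ 2) ^ (-(1/4) : ℝ) :=
            Real.rpow_le_rpow_of_nonpos (by positivity) hd (by norm_num)
        _ = _ := by rw [← Real.rpow_natCast, ← Real.rpow_mul hab.le]; norm_num
  · subst h
    unfold GG
    simp
  · have : ∀ x : ℝ, WW (x^2+r^2) ((x-s)^2+r^2) = 0 := by
      intro x
      unfold WW
      rw [if_neg]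
      rintro ⟨h1, -⟩
      nlinarith [sq_nonneg x]
    simp [this]

lemma outer_bound (ρ : ℝ) (h0 : 0 ≤ ρ) (h1 : ρ ≤ 1) (n : ℕ) :
    ∫⁻ r in Set.Ioi (0:ℝ), ENNReal.ofReal (r ^ n) * GG ρ r ≤ 12 * (8 + (8 + 8)) := by
  have e : ∀ r ∈ Set.Ioi (0:ℝ), ENNReal.ofReal (r ^ n) * GG ρ r ≤ GG ρ r := by
    intro r hr
    by_cases h : r ≤ 1
    · refine mul_le_of_le_one_left' ?_
      rw [ENNReal.ofReal_le_one]
      exact pow_le_one₀ (le_of_lt hr) h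
    · have : GG ρ r = 0 := by unfold GG; simp [h]
      simp [this]
  have R : ∀ a : ℝ, ∫⁻ x in Set.Ioo a (a+1), ENNReal.ofReal |a - x| ^ (-(7/8) : ℝ) ≤ 8 := by
    intro a
    have := lint_right a (a+1) (7/8) (by norm_num) (by linarith)
    rw [add_sub_cancel_left, Real.one_rpow] at this
    norm_num at this
    refine le_trans (le_of_eq ?_) this.le
    refine setLIntegral_congr_fun measurableSet_Ioo fun x hx => ?_
    have : 0 < x - a := by linarith [hx.1]
    rw [abs_sub_comm, abs_of_pos this, ENNReal.ofReal_rpow_of_pos this]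
  have L : ∀ a : ℝ, ∫⁻ x in Set.Ioo (a-1) a, ENNReal.ofReal |a - x| ^ (-(7/8) : ℝ) ≤ 8 := by
    intro a
    have := lint_left (a-1) a (7/8) (by norm_num) (by linarith)
    rw [sub_sub_cancel, Real.one_rpow] at this
    norm_num at this
    refine le_trans (le_of_eq ?_) this.le
    refine setLIntegral_congr_fun measurableSet_Ioo fun x hx => ?_
    have : 0 < a - x := by linarith [hx.2]
    rw [abs_of_pos this, ENNReal.ofReal_rpow_of_pos this]
  refine (setLIntegral_mono' measurableSet_Ioi e).trans ?_
  unfold GG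
  rw [setLIntegral_indicator measurableSet_Iic, Set.inter_comm, Set.Ioi_inter_Iic,
    ← restrict_Ioo_eq_restrict_Ioc, lintegral_const_mul _ (by fun_prop), lintegral_add_left (by fun_prop)]
  gcongr
  · have := L 1
    rw [sub_self] at this
    refine le_trans (le_of_eq ?_) this
    refine setLIntegral_congr_fun measurableSet_Ioo fun x hx => ?_
    rw [abs_of_pos (by linarith [hx.2])]
  · have hsub : Set.Ioo (0:ℝ) 1 ⊆ (Set.Ioo (ρ-1) ρ ∪ Set.Ioo ρ (ρ+1)) ∪ {ρ} := by
      intro x hx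
      rcases lt_trichotomy x ρ with h | h | h
      · exact Or.inl (Or.inl ⟨by linarith [hx.1], h⟩)
      · exact Or.inr h
      · exact Or.inl (Or.inr ⟨h, by linarith [hx.2]⟩)
    refine (lintegral_mono_set hsub).trans ((lintegral_union_le _ _ _).trans ?_)
    simp only [Measure.restrict_singleton, measure_singleton, zero_smul, lintegral_zero_measure, add_zero]
    exact (lintegral_union_le _ _ _).trans (add_le_add (L ρ) (R ρ))

/-- for `d ≥ 2` the function
`Φ_d(k) = ∫_{|p|≤1, |p−k|≥1} dp/((1−|p|²)^{1/2} (|p−k|²−1)^{1/2})`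
is uniformly bounded on `ℝ^d`. -/
theorem Phid_bounded (d : ℕ) (hd : 2 ≤ d) :
    ∃ C : ℝ, ∀ k : EuclideanSpace ℝ (Fin d),
      (∫ p in {p : EuclideanSpace ℝ (Fin d) | ‖p‖ ≤ 1 ∧ 1 ≤ ‖p - k‖},
        (Real.sqrt (1 - ‖p‖ ^ 2) * Real.sqrt (‖p - k‖ ^ 2 - 1))⁻¹) ≤ C := by
  obtain ⟨n, rfl⟩ : ∃ n, d = n + 1 + 1 := ⟨d - 2, by omega⟩
  set K : ENNReal := (volume : Measure (EuclideanSpace ℝ (Fin (n+1)))).toSphere Set.univ *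
    (12 * (8 + (8 + 8))) with hK
  have hKtop : K ≠ ⊤ := ENNReal.mul_ne_top (measure_ne_top _ _) (by finiteness)
  refine ⟨K.toReal, fun k => ?_⟩
  by_cases hk : k = 0
  · subst hk
    refine le_trans (le_of_eq ?_) ENNReal.toReal_nonneg
    refine integral_eq_zero_of_ae ?_
    refine Filter.Eventually.of_forall fun p => ?_
    simp only [sub_zero, Pi.zero_apply, inv_eq_zero, mul_eq_zero]
    rcases le_total (‖p‖^2) 1 with h | h
    · exact Or.inr (Real.sqrt_eq_zero_of_nonpos (by linarith))
    · exact Or.inl (Real.sqrt_eq_zero_of_nonpos (by linarith))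
  have hs : 0 < ‖k‖ := norm_pos_iff.2 hk
  rw [← ENNReal.ofReal_le_iff_le_toReal hKtop]
  refine (step1 volume k).trans ?_
  rw [step2, step3]
  refine (lintegral_mono fun y => inner_GG ‖y‖ ‖k‖ (norm_nonneg _) hs).trans ?_
  rw [polar_bound volume _ (GG_meas _), hK]
  gcongr
  refine outer_bound _ (Real.sqrt_nonneg _) ?_ _
  refine Real.sqrt_le_iff.2 ⟨zero_le_one, ?_⟩
  nlinarith [sq_nonneg (‖k‖/2)]
end

section
/- For d ≥ 2, Φ_d admits the slicing representation Φ_d(k) = |S^{d−2}| ∫₀¹ (r^{d−2}/√(1−r²)) · Φ₁(k/√(1−r²)) dr, where Φ₁(x) = ∫_{{v²≤1, (v−x)²≥1}} dv/(√(1−v²)·√((v−x)²−1)). -/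
open MeasureTheory

/-- The one-dimensional function
`Φ₁(x) = ∫_{v²≤1, (v−x)²≥1} dv/(√(1−v²) √((v−x)²−1))`. -/
noncomputable def Phi1 (x : ℝ) : ℝ :=
  ∫ v in {v : ℝ | v ^ 2 ≤ 1 ∧ 1 ≤ (v - x) ^ 2},
    (Real.sqrt (1 - v ^ 2) * Real.sqrt ((v - x) ^ 2 - 1))⁻¹

lemma measSet_and {α : Type*} [MeasurableSpace α] (f g : α → ℝ) (hf : Measurable f)
    (hg : Measurable g) : MeasurableSet {x : α | f x ≤ 1 ∧ 1 ≤ g x} :=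
  (measurableSet_le hf measurable_const).inter (measurableSet_le measurable_const hg)

/-- The one-dimensional integrand, extended by zero. -/
noncomputable def gAux (x v : ℝ) : ℝ :=
  Set.indicator {v : ℝ | v ^ 2 ≤ 1 ∧ 1 ≤ (v - x) ^ 2}
    (fun v => (Real.sqrt (1 - v ^ 2) * Real.sqrt ((v - x) ^ 2 - 1))⁻¹) v

/-- The integrand in cylindrical coordinates, extended by zero. -/
noncomputable def fAux (k : ℝ) (z : ℝ × ℝ) : ℝ :=
  Set.indicator {z : ℝ × ℝ | z.1 ^ 2 + z.2 ^ 2 ≤ 1 ∧ 1 ≤ (z.1 - k) ^ 2 + z.2 ^ 2}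
    (fun z => (Real.sqrt (1 - (z.1 ^ 2 + z.2 ^ 2)) *
      Real.sqrt ((z.1 - k) ^ 2 + z.2 ^ 2 - 1))⁻¹) z

lemma measurable_gAux (x : ℝ) : Measurable (gAux x) := by
  unfold gAux
  apply Measurable.indicator
  · fun_prop
  · exact measSet_and _ _ (by fun_prop) (by fun_prop)

lemma measurable_fAux (k : ℝ) : Measurable (fAux k) := by
  unfold fAux
  apply Measurable.indicator
  · fun_prop
  · exact measSet_and _ _ (by fun_prop) (by fun_prop)

lemma fAux_nonneg (k : ℝ) (z : ℝ × ℝ) : 0 ≤ fAux k z := by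
  unfold fAux
  apply Set.indicator_nonneg
  intro z _
  positivity

lemma gAux_nonneg (k z : ℝ) : 0 ≤ gAux k z := by
  unfold gAux
  apply Set.indicator_nonneg
  intro z _
  positivity

lemma Phi1_eq (x : ℝ) : Phi1 x = ∫ v, gAux x v := by
  unfold Phi1 gAux
  rw [integral_indicator]
  exact measSet_and _ _ (by fun_prop) (by fun_prop)

lemma integrable_left (c a b : ℝ) :
    IntegrableOn (fun v : ℝ => (v - c) ^ (-(1/2) : ℝ)) (Set.Icc a b) := by
  rcases le_total a b with hab | hab
  · rw [← intervalIntegrable_iff_integrableOn_Icc_of_le hab]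
    have := (intervalIntegral.intervalIntegrable_rpow' (a := a - c) (b := b - c)
      (r := -(1/2)) (by norm_num)).comp_sub_right c
    simpa using this
  · rcases hab.eq_or_lt with h | h
    · subst h; simp
    · simp [Set.Icc_eq_empty (not_le.2 h)]

lemma integrable_right (c a b : ℝ) :
    IntegrableOn (fun v : ℝ => (c - v) ^ (-(1/2) : ℝ)) (Set.Icc a b) := by
  rcases le_total a b with hab | hab
  · rw [← intervalIntegrable_iff_integrableOn_Icc_of_le hab]
    have := (intervalIntegral.intervalIntegrable_rpow' (a := c - a) (b := c - b)
      (r := -(1/2)) (by norm_num)).comp_sub_left c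
    simpa using this
  · rcases hab.eq_or_lt with h | h
    · subst h; simp
    · simp [Set.Icc_eq_empty (not_le.2 h)]

lemma rpow_half (a : ℝ) (ha : 0 ≤ a) : a ^ (-(1/2) : ℝ) = (Real.sqrt a)⁻¹ := by
  rw [Real.rpow_neg ha, Real.sqrt_eq_rpow]

lemma inv_sqrt_mul_le (a b c : ℝ) (ha : 0 ≤ a) (hc : 0 < c) (h : c ≤ a + b) :
    (Real.sqrt (a * b))⁻¹ ≤ (Real.sqrt (c / 2))⁻¹ * ((Real.sqrt a)⁻¹ + (Real.sqrt b)⁻¹) := by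
  rw [Real.sqrt_mul ha, mul_inv]
  have h0 : 0 < Real.sqrt (c / 2) := Real.sqrt_pos.2 (by positivity)
  have hA : 0 ≤ (Real.sqrt a)⁻¹ := by positivity
  have hB : 0 ≤ (Real.sqrt b)⁻¹ := by positivity
  have hC : 0 ≤ (Real.sqrt (c / 2))⁻¹ := by positivity
  rcases le_total a b with hab | hab
  · have : (Real.sqrt b)⁻¹ ≤ (Real.sqrt (c / 2))⁻¹ :=
      inv_anti₀ h0 (Real.sqrt_le_sqrt (by linarith))
    nlinarith [mul_le_mul_of_nonneg_left this hA, mul_nonneg hC hB]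
  · have : (Real.sqrt a)⁻¹ ≤ (Real.sqrt (c / 2))⁻¹ :=
      inv_anti₀ h0 (Real.sqrt_le_sqrt (by linarith))
    nlinarith [mul_le_mul_of_nonneg_left this hB, mul_nonneg hC hA]

lemma integrable_gAux (x : ℝ) (hx : 0 < x) (hx2 : x ≠ 2) : Integrable (gAux x) := by
  set e := min 1 (x - 1) with he
  set m := max 1 (x - 1) with hm
  have hem : 0 < m - e := by
    rcases lt_or_gt_of_ne hx2 with h | h
    · rw [he, hm, min_eq_right (by linarith), max_eq_left (by linarith)]; linarith
    · rw [he, hm, min_eq_left (by linarith), max_eq_right (by linarith)]; linarith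
  have he1 : 0 < e + 1 := by
    rcases min_choice 1 (x - 1) with h | h <;> rw [he, h] <;> linarith
  have hprod : ∀ v, (1 - v) * (x - 1 - v) = (e - v) * (m - v) := by
    intro v
    rcases le_total 1 (x - 1) with h | h
    · rw [he, hm, min_eq_left h, max_eq_right h]
    · rw [he, hm, min_eq_right h, max_eq_left h]; ring
  have hint : Integrable (Set.indicator (Set.Icc (-1) e) (fun v : ℝ =>
      (Real.sqrt (2 * (m - e)))⁻¹ * ((Real.sqrt ((e + 1) / 2))⁻¹ *
        ((v - (-1)) ^ (-(1/2) : ℝ) + (e - v) ^ (-(1/2) : ℝ))))) := by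
    rw [integrable_indicator_iff measurableSet_Icc]
    exact (((integrable_left (-1) (-1) e).add (integrable_right e (-1) e)).const_mul _).const_mul _
  refine hint.mono' (measurable_gAux x).aestronglyMeasurable (Filter.Eventually.of_forall ?_)
  intro v
  rw [Real.norm_of_nonneg (gAux_nonneg x v)]
  by_cases hv : v ∈ {v : ℝ | v ^ 2 ≤ 1 ∧ 1 ≤ (v - x) ^ 2}
  · have hv0 := hv
    obtain ⟨h1, h2⟩ := hv
    have hv1 : -1 ≤ v ∧ v ≤ 1 := abs_le.1 ((sq_le_one_iff_abs_le_one v).1 h1)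
    have hv2 : v ≤ x - 1 := by
      by_contra h
      push Not at h
      nlinarith
    have hve : v ≤ e := le_min hv1.2 hv2
    have hve' : 0 ≤ e - v := by linarith
    have h1v : 0 ≤ 1 + v := by linarith
    unfold gAux
    rw [Set.indicator_of_mem hv0, Set.indicator_of_mem (Set.mem_Icc.2 ⟨hv1.1, hve⟩)]
    rw [rpow_half _ (by linarith), rpow_half _ hve', ← Real.sqrt_mul (by linarith)]
    have heq : (1 - v ^ 2) * ((v - x) ^ 2 - 1)
        = ((m - v) * (x - v + 1)) * ((v - (-1)) * (e - v)) := by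
      linear_combination (1 + v) * (x - v + 1) * hprod v
    rw [heq, Real.sqrt_mul (mul_nonneg (by linarith) (by linarith)), mul_inv]
    apply mul_le_mul
    · apply inv_anti₀ (Real.sqrt_pos.2 (by positivity))
      apply Real.sqrt_le_sqrt
      nlinarith
    · apply inv_sqrt_mul_le <;> linarith
    · positivity
    · positivity
  · unfold gAux
    rw [Set.indicator_of_notMem hv]
    apply Set.indicator_nonneg
    intro v hv
    have h1 : 0 ≤ v - (-1) := by linarith [hv.1]
    have h2 : 0 ≤ e - v := by linarith [hv.2]
    positivity

lemma fAux_scale (k r v : ℝ) (hr : r ^ 2 < 1) :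
    fAux k (Real.sqrt (1 - r ^ 2) * v, r) =
      (1 - r ^ 2)⁻¹ * gAux (k / Real.sqrt (1 - r ^ 2)) v := by
  set w := Real.sqrt (1 - r ^ 2) with hw
  have hw0 : 0 < w := Real.sqrt_pos.2 (by linarith)
  have hw2 : w ^ 2 = 1 - r ^ 2 := Real.sq_sqrt (by linarith)
  have hw2p : 0 < w ^ 2 := by positivity
  have e1 : 1 - ((w * v) ^ 2 + r ^ 2) = w ^ 2 * (1 - v ^ 2) := by linear_combination -hw2
  have e2 : (w * v - k) ^ 2 + r ^ 2 - 1 = w ^ 2 * ((v - k / w) ^ 2 - 1) := by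
    have : w * v - k = w * (v - k / w) := by field_simp
    rw [this]; linear_combination hw2
  have m1 : (w * v) ^ 2 + r ^ 2 ≤ 1 ↔ v ^ 2 ≤ 1 := by
    rw [← sub_nonneg, e1, mul_nonneg_iff_of_pos_left hw2p, sub_nonneg]
  have m2 : 1 ≤ (w * v - k) ^ 2 + r ^ 2 ↔ 1 ≤ (v - k / w) ^ 2 := by
    rw [← sub_nonneg, e2, mul_nonneg_iff_of_pos_left hw2p, sub_nonneg]
  unfold fAux gAux
  simp only [Set.indicator_apply, Set.mem_ofPred_eq, m1, m2]
  split_ifs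
  · rw [e1, e2, Real.sqrt_mul hw2p.le, Real.sqrt_mul hw2p.le, Real.sqrt_sq hw0.le, ← hw2]
    simp only [mul_inv]
    ring
  · simp

lemma fAux_zero (k r s : ℝ) (hr : 1 < r ^ 2) : fAux k (s, r) = 0 := by
  unfold fAux
  apply Set.indicator_of_notMem
  rintro ⟨h, -⟩
  simp only at h
  nlinarith [sq_nonneg s]

lemma integral_fAux (k r : ℝ) (hr : r ^ 2 < 1) :
    ∫ s, fAux k (s, r) = (Real.sqrt (1 - r ^ 2))⁻¹ * Phi1 (k / Real.sqrt (1 - r ^ 2)) := by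
  have hw0 : 0 < Real.sqrt (1 - r ^ 2) := Real.sqrt_pos.2 (by linarith)
  have hw2 : Real.sqrt (1 - r ^ 2) ^ 2 = 1 - r ^ 2 := Real.sq_sqrt (by linarith)
  have h := Measure.integral_comp_mul_left (fun s => fAux k (s, r)) (Real.sqrt (1 - r ^ 2))
  simp only [fAux_scale k r _ hr] at h
  rw [integral_const_mul, ← Phi1_eq, abs_of_pos (inv_pos.2 hw0), smul_eq_mul, ← hw2,
    Real.sqrt_sq hw0.le] at h
  rw [eq_comm, inv_mul_eq_iff_eq_mul₀ hw0.ne'] at h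
  rw [h]
  field_simp

lemma integrable_fAux (k r : ℝ) (hk : 0 < k) (hr : r ^ 2 ≠ 1) (hr2 : r ^ 2 ≠ 1 - k ^ 2 / 4) :
    Integrable (fun s => fAux k (s, r)) := by
  rcases lt_or_gt_of_ne hr with h | h
  · have hw0 : 0 < Real.sqrt (1 - r ^ 2) := Real.sqrt_pos.2 (by linarith)
    have hw2 : Real.sqrt (1 - r ^ 2) ^ 2 = 1 - r ^ 2 := Real.sq_sqrt (by linarith)
    rw [← integrable_comp_mul_left_iff (fun s => fAux k (s, r)) hw0.ne']
    simp only [fAux_scale k r _ h]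
    apply Integrable.const_mul
    apply integrable_gAux
    · positivity
    · intro h2
      rw [div_eq_iff hw0.ne'] at h2
      apply hr2
      rw [h2, mul_pow, hw2]; ring
  · simp only [fAux_zero k r _ h]
    exact integrable_zero _ _ _

lemma integral_prod_nonneg {α β : Type*} [MeasurableSpace α] [MeasurableSpace β]
    (μ : Measure α) (ν : Measure β) [SFinite μ] [SFinite ν] (f : α × β → ℝ)
    (hf : Measurable f) (h0 : ∀ z, 0 ≤ f z) (hi : ∀ᵐ y ∂ν, Integrable (fun x => f (x, y)) μ) :
    ∫ z, f z ∂(μ.prod ν) = ∫ y, ∫ x, f (x, y) ∂μ ∂ν := by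
  rw [integral_eq_lintegral_of_nonneg_ae (.of_forall h0) hf.aestronglyMeasurable,
    integral_eq_lintegral_of_nonneg_ae (.of_forall fun y => integral_nonneg fun x => h0 _)
      (StronglyMeasurable.integral_prod_left' (f := f) hf.stronglyMeasurable).aestronglyMeasurable,
    lintegral_prod_symm _ hf.ennreal_ofReal.aemeasurable]
  congr 1
  apply lintegral_congr_ae
  filter_upwards [hi] with y hy
  rw [ofReal_integral_eq_lintegral_ofReal hy (.of_forall fun x => h0 _)]

/-- Splitting off the first coordinate. -/
noncomputable def TAux (n : ℕ) (p : EuclideanSpace ℝ (Fin (n + 2))) :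
    ℝ × EuclideanSpace ℝ (Fin (n + 1)) :=
  (p 0, WithLp.toLp 2 (fun j => p j.succ))

lemma TAux_mp (n : ℕ) : MeasurePreserving (TAux n) volume (volume.prod volume) := by
  have h1 := PiLp.volume_preserving_ofLp (Fin (n + 2))
  have h2 := volume_preserving_piFinSuccAbove (fun _ : Fin (n + 2) => ℝ) 0
  have h3 := (MeasurePreserving.id (volume : Measure ℝ)).prod
    (PiLp.volume_preserving_toLp (Fin (n + 1)))
  exact h3.comp (h2.comp h1)

lemma Phid_slicing_aux (n : ℕ) (k : ℝ) (hk : 0 < k) :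
    (∫ p in {p : EuclideanSpace ℝ (Fin (n + 2)) |
          ‖p‖ ≤ 1 ∧ 1 ≤ ‖p - k • EuclideanSpace.single (0 : Fin (n + 2)) (1 : ℝ)‖},
        (Real.sqrt (1 - ‖p‖ ^ 2)
          * Real.sqrt (‖p - k • EuclideanSpace.single (0 : Fin (n + 2)) (1 : ℝ)‖ ^ 2 - 1))⁻¹)
      = ((n : ℝ) + 1) * (volume (Metric.ball (0 : EuclideanSpace ℝ (Fin (n + 1))) 1)).toReal
        * ∫ r in Set.Ioo (0 : ℝ) 1,
            ((r : ℝ) ^ n / Real.sqrt (1 - r ^ 2)) * Phi1 (k / Real.sqrt (1 - r ^ 2)) := by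
  set E := EuclideanSpace ℝ (Fin (n + 1))
  have n1 : ∀ p : EuclideanSpace ℝ (Fin (n + 2)),
      ‖p‖ ^ 2 = (TAux n p).1 ^ 2 + ‖(TAux n p).2‖ ^ 2 := by
    intro p
    simp [TAux, EuclideanSpace.norm_sq_eq, Fin.sum_univ_succ (n := n + 1)]
  have n2 : ∀ p : EuclideanSpace ℝ (Fin (n + 2)),
      ‖p - k • EuclideanSpace.single (0 : Fin (n + 2)) (1 : ℝ)‖ ^ 2
        = ((TAux n p).1 - k) ^ 2 + ‖(TAux n p).2‖ ^ 2 := by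
    intro p
    simp [TAux, EuclideanSpace.norm_sq_eq, Fin.sum_univ_succ (n := n + 1)]
  have hmeas : Measurable (fun z : ℝ × E => fAux k (z.1, ‖z.2‖)) :=
    (measurable_fAux k).comp (measurable_fst.prodMk measurable_snd.norm)
  have step1 : (∫ p in {p : EuclideanSpace ℝ (Fin (n + 2)) |
          ‖p‖ ≤ 1 ∧ 1 ≤ ‖p - k • EuclideanSpace.single (0 : Fin (n + 2)) (1 : ℝ)‖},
        (Real.sqrt (1 - ‖p‖ ^ 2)
          * Real.sqrt (‖p - k • EuclideanSpace.single (0 : Fin (n + 2)) (1 : ℝ)‖ ^ 2 - 1))⁻¹)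
      = ∫ z : ℝ × E, fAux k (z.1, ‖z.2‖) ∂(volume.prod volume) := by
    rw [← (TAux_mp n).map_eq, integral_map (TAux_mp n).measurable.aemeasurable
      hmeas.aestronglyMeasurable, ← integral_indicator]
    · congr 1
      ext p
      unfold fAux
      simp only [Set.indicator_apply, Set.mem_ofPred_eq, ← n1, ← n2]
      simp only [sq_le_one_iff₀ (norm_nonneg _), one_le_sq_iff₀ (norm_nonneg _)]
    · exact measSet_and _ _ (by fun_prop) (by fun_prop)
  have hae : ∀ᵐ q : E, Integrable (fun s => fAux k (s, ‖q‖)) := by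
    have a1 : ∀ᵐ q : E, q ∉ Metric.sphere (0 : E) 1 :=
      measure_eq_zero_iff_ae_notMem.1 (Measure.addHaar_sphere _ _ _)
    have a2 : ∀ᵐ q : E, q ∉ Metric.sphere (0 : E) (Real.sqrt (1 - k ^ 2 / 4)) :=
      measure_eq_zero_iff_ae_notMem.1 (Measure.addHaar_sphere _ _ _)
    filter_upwards [a1, a2] with q h1 h2
    rw [mem_sphere_zero_iff_norm] at h1 h2
    apply integrable_fAux k _ hk
    · intro h
      exact h1 (by nlinarith [norm_nonneg q])
    · intro h
      apply h2
      rw [← h, Real.sqrt_sq (norm_nonneg q)]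
  rw [step1, integral_prod_nonneg _ _ (fun z : ℝ × E => fAux k (z.1, ‖z.2‖)) hmeas
    (fun z => fAux_nonneg k _) hae]
  have step2 := integral_fun_norm_addHaar (volume : Measure E) (fun r => ∫ s, fAux k (s, r))
  simp only at step2 ⊢
  rw [step2]
  have hdim : Module.finrank ℝ E = n + 1 := by simp [E]
  rw [hdim, nsmul_eq_mul, smul_eq_mul, ← mul_assoc]
  simp only [Nat.add_sub_cancel, Nat.cast_add, Nat.cast_one, smul_eq_mul, Measure.real]
  congr 1
  rw [← Set.Ioo_union_Ici_eq_Ioi (zero_lt_one' ℝ)]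
  rw [setIntegral_congr_set (t := Set.Ioo 0 1 ∪ Set.Ioi 1)
    ((Filter.EventuallyEq.refl _ _).union Ioi_ae_eq_Ici.symm)]
  rw [setIntegral_eq_of_subset_of_forall_sdiff_eq_zero (s := Set.Ioo 0 1)
    (measurableSet_Ioo.union measurableSet_Ioi) Set.subset_union_left]
  · apply setIntegral_congr_fun measurableSet_Ioo
    intro r hr
    simp only
    rw [integral_fAux k r (by nlinarith [hr.1, hr.2])]
    ring
  · rintro r ⟨hr | hr, hr'⟩
    · exact absurd hr hr'
    · have : 1 < r ^ 2 := by
        have : 1 < r := hr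
        nlinarith
      simp [fAux_zero k r _ this]

/-- slicing representation
`Φ_d(k) = |S^{d−2}| ∫₀¹ (r^{d−2}/√(1−r²)) Φ₁(k/√(1−r²)) dr` for `d ≥ 2`,
where `|S^{d−2}|` is the surface area of the unit sphere in `ℝ^{d−1}`
(expressed as `(d−1)` times the volume of the unit ball in `ℝ^{d−1}`). -/
theorem Phid_slicing (d : ℕ) (hd : 2 ≤ d) (k : ℝ) (hk : 0 < k) :
    (∫ p in {p : EuclideanSpace ℝ (Fin d) |
          ‖p‖ ≤ 1 ∧ 1 ≤ ‖p - k • EuclideanSpace.single (⟨0, by omega⟩ : Fin d) (1 : ℝ)‖},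
        (Real.sqrt (1 - ‖p‖ ^ 2)
          * Real.sqrt (‖p - k • EuclideanSpace.single (⟨0, by omega⟩ : Fin d) (1 : ℝ)‖ ^ 2 - 1))⁻¹)
      = ((d : ℝ) - 1) * (volume (Metric.ball (0 : EuclideanSpace ℝ (Fin (d - 1))) 1)).toReal
        * ∫ r in Set.Ioo (0 : ℝ) 1,
            ((r : ℝ) ^ (d - 2) / Real.sqrt (1 - r ^ 2)) * Phi1 (k / Real.sqrt (1 - r ^ 2)) := by
  obtain ⟨n, rfl⟩ : ∃ n, d = n + 2 := ⟨d - 2, by omega⟩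
  have h := Phid_slicing_aux n k hk
  have e : (((n + 2 : ℕ) : ℝ) - 1) = (n : ℝ) + 1 := by push_cast; ring
  rw [e]
  exact h
end

section
/- The two-dimensional response function Ψ₂ satisfies the closed form Ψ₂(k) = 1/(8π) − (1/(8π))·√((1 − 4/|k|²)_+) for all k ≠ 0, where Ψ₂(k) = (2π)^{−2} ∫_{{|p|≤1, |p−k|≥1}} dp/(|p−k|² − |p|²) over p ∈ ℝ². In particular Ψ₂ is constant equal to 1/(8π) on 0 < |k| ≤ 2 and strictly decreasing on [2,∞). -/
open Real MeasureTheory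
/-- half-length slice -/
lemma slice_set {a c s : ℝ} (ha : 0 < a) (hcs : c^2+s^2=1) (hc : 0 < c) (h : 0 ≤ 1 - a^2*s^2) :
   {r : ℝ | r^2-2*a*r*c+a^2≤1 ∧ 1≤ r^2+2*a*r*c+a^2} ∩ Set.Ioi 0 = Set.Icc |√(1-a^2*s^2) - a*c| (√(1-a^2*s^2) + a*c) ∩ Set.Ioi 0 := by
  have hD := Real.sq_sqrt h
  have hD0 := Real.sqrt_nonneg (1-a^2*s^2)
  set D := √(1-a^2*s^2)
  have hac : 0 < a * c := by positivity
  have key : D^2 = 1 - a^2 + (a*c)^2 := by rw [hD]; linear_combination (-a^2)*hcs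
  ext r
  simp only [Set.mem_inter_iff, Set.mem_ofPred_eq, Set.mem_Ioi, Set.mem_Icc, and_congr_left_iff]
  intro hr
  rw [abs_le]
  constructor
  · rintro ⟨h1, h2⟩
    have e1 : |r - a*c| ≤ |D| := sq_le_sq.1 (by nlinarith)
    have e2 : |D| ≤ |r + a*c| := sq_le_sq.1 (by nlinarith)
    rw [abs_of_nonneg hD0] at e1 e2
    rw [abs_of_pos (by linarith)] at e2
    rw [abs_le] at e1
    refine ⟨⟨?_, ?_⟩, ?_⟩ <;> linarith [e1.1, e1.2]
  · rintro ⟨⟨h1, h2⟩, h3⟩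
    constructor
    · nlinarith
    · nlinarith

lemma slice_int {a c s : ℝ} (ha : 0 < a) (hcs : c^2+s^2=1) :
   IntegrableOn (Set.indicator {r : ℝ | r^2-2*a*r*c+a^2≤1 ∧ 1≤ r^2+2*a*r*c+a^2} (fun _ => (4*a*c)⁻¹)) (Set.Ioi 0) ∧ 
   ∫ r in Set.Ioi 0, Set.indicator {r : ℝ | r^2-2*a*r*c+a^2≤1 ∧ 1≤ r^2+2*a*r*c+a^2} (fun _ => (4*a*c)⁻¹) r = if 0 < c then min √(1-a^2*s^2) (a*c) / (2*a*c) else 0 := by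
  set K := {r : ℝ | r^2-2*a*r*c+a^2≤1 ∧ 1≤ r^2+2*a*r*c+a^2} with hK
  have hKm : MeasurableSet K := by
    exact (measurableSet_le (f := fun r : ℝ => r^2-2*a*r*c+a^2) (g := fun _ => 1) (by fun_prop) (by fun_prop)).inter
      (measurableSet_le (f := fun _ => 1) (g := fun r : ℝ => r^2+2*a*r*c+a^2) (by fun_prop) (by fun_prop))
  have hzero : (∀ r ∈ Set.Ioi (0:ℝ), K.indicator (fun _ => (4*a*c)⁻¹) r = 0) → 
     IntegrableOn (K.indicator (fun _ => (4*a*c)⁻¹)) (Set.Ioi 0) ∧ ∫ r in Set.Ioi 0, K.indicator (fun _ => (4*a*c)⁻¹) r = 0 := by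
    intro h
    exact ⟨(integrableOn_congr_fun h measurableSet_Ioi).2 integrableOn_zero, setIntegral_eq_zero_of_forall_eq_zero h⟩
  by_cases hc : 0 < c
  · rw [if_pos hc]
    by_cases h : 0 ≤ 1 - a^2*s^2
    · have hs := slice_set ha hcs hc h
      rw [← hK] at hs
      have hD0 := Real.sqrt_nonneg (1-a^2*s^2)
      set D := √(1-a^2*s^2)
      have hac : 0 < a * c := by positivity
      have hs2 : (Set.Ioi 0 ∩ K : Set ℝ) =ᵐ[volume] Set.Icc |D - a*c| (D + a*c) := by
        rw [Set.inter_comm, hs]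
        apply Filter.EventuallyEq.trans (ae_eq_set_inter (Filter.EventuallyEq.refl _ _) Ioi_ae_eq_Ici)
        refine Filter.EventuallyEq.of_eq (Set.inter_eq_left.2 ?_)
        intro r hr
        exact (abs_nonneg _).trans hr.1
      constructor
      · rw [IntegrableOn, integrable_indicator_iff hKm, IntegrableOn, Measure.restrict_restrict hKm, Set.inter_comm, Measure.restrict_congr_set hs2]
        exact integrable_const _
      · rw [setIntegral_indicator hKm, setIntegral_congr_set hs2, setIntegral_const, Real.volume_real_Icc_of_le (by rw [abs_le]; constructor <;> linarith)]
        have : D + a*c - |D - a*c| = 2 * min D (a*c) := by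
          rcases le_total D (a*c) with h | h
          · rw [min_eq_left h, abs_of_nonpos (by linarith)]; ring
          · rw [min_eq_right h, abs_of_nonneg (by linarith)]; ring
        rw [this, smul_eq_mul]
        field_simp
        ring
    · rw [Real.sqrt_eq_zero_of_nonpos (by linarith), min_eq_left (by positivity), zero_div]
      apply hzero
      intro r hr
      apply Set.indicator_of_notMem
      rintro ⟨h1, -⟩
      apply h
      have : a^2*c^2 = a^2 - a^2*s^2 := by linear_combination a^2*hcs
      nlinarith [sq_nonneg (r - a*c)]
  · rw [if_neg hc]
    apply hzero
    intro r hr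
    rcases (not_lt.1 hc).lt_or_eq with h | h
    · apply Set.indicator_of_notMem
      rintro ⟨h1, h2⟩
      have : 0 < a * r * (-c) := mul_pos (mul_pos ha hr) (by linarith)
      nlinarith
    · subst h; simp [Set.indicator]

lemma theta_small {a : ℝ} (ha : 0 < a) (ha1 : a ≤ 1) :
   ∫ θ in Set.Ioo (-π) π, (if 0 < cos θ then min √(1-a^2*sin θ^2) (a*cos θ) / (2*a*cos θ) else 0) = π/2 := by
  have : ∀ θ ∈ Set.Ioo (-π) π, (if 0 < cos θ then min √(1-a^2*sin θ^2) (a*cos θ) / (2*a*cos θ) else 0) = Set.indicator (Set.Ioo (-(π/2)) (π/2)) (fun _ => (1/2:ℝ)) θ := by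
    intro θ hθ
    by_cases h : θ ∈ Set.Ioo (-(π/2)) (π/2)
    · have hc := cos_pos_of_mem_Ioo h
      rw [if_pos hc, Set.indicator_of_mem h, min_eq_right]
      · field_simp
      · apply Real.le_sqrt_of_sq_le
        nlinarith [sin_sq_add_cos_sq θ]
    · rw [Set.indicator_of_notMem h, if_neg]
      rw [not_lt, ← cos_abs]
      have : |θ| < π := abs_lt.2 hθ
      apply cos_nonpos_of_pi_div_two_le_of_le
      · by_contra! h'
        exact h (abs_lt.1 h')
      · linarith [pi_pos]
  rw [setIntegral_congr_fun measurableSet_Ioo this, setIntegral_indicator measurableSet_Ioo, Set.inter_eq_right.2, setIntegral_const, Real.volume_real_Ioo_of_le (by linarith [pi_pos])]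
  · simp; ring
  · apply Set.Ioo_subset_Ioo <;> linarith [pi_pos]

lemma theta_large {a : ℝ} (ha : 1 < a) :
   ∫ θ in Set.Ioo (-π) π, (if 0 < cos θ then min √(1-a^2*sin θ^2) (a*cos θ) / (2*a*cos θ) else 0) = π/2 * (1 - √(a^2-1)/a) := by
  set β := arcsin (1/a) with hβ
  have ha0 : 0 < a := by linarith
  have h1a : 1/a < 1 := by rw [div_lt_one ha0]; exact ha
  have h1a0 : 0 < 1/a := by positivity
  have hβ0 : 0 < β := arcsin_pos.2 h1a0
  have hβ1 : β < π/2 := arcsin_lt_pi_div_two.2 h1a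
  have hsβ : sin β = 1/a := sin_arcsin (by linarith) h1a.le
  have hb : 0 < a^2-1 := by nlinarith
  set b := √(a^2-1) with hbdef
  have hb2 : b^2 = a^2-1 := Real.sq_sqrt hb.le
  have hb0 : 0 < b := Real.sqrt_pos.2 hb
  have hcβ : cos β = b / a := by
    rw [hβ, cos_arcsin, Real.sqrt_eq_iff_mul_self_eq_of_pos (by positivity)]
    field_simp
    linarith
  -- congruence
  have : ∀ θ ∈ Set.Ioo (-π) π, (if 0 < cos θ then min √(1-a^2*sin θ^2) (a*cos θ) / (2*a*cos θ) else 0) = Set.indicator (Set.Ioc (-β) β) (fun θ => (1/(2*a)) * (√(1-a^2*sin θ^2) / cos θ)) θ := by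
    intro θ hθ
    by_cases h : 0 < cos θ
    · have hθ2 : |θ| < π/2 := by
        by_contra! h'
        have := cos_nonpos_of_pi_div_two_le_of_le h' (by linarith [abs_lt.2 hθ, pi_pos])
        rw [cos_abs] at this
        linarith
      have hθ3 := abs_lt.1 hθ2
      rw [if_pos h, min_eq_left]
      · by_cases hm : θ ∈ Set.Ioc (-β) β
        · rw [Set.indicator_of_mem hm]; field_simp
        · rw [Set.indicator_of_notMem hm, Real.sqrt_eq_zero_of_nonpos, zero_div]
          have : 1 / a ≤ |sin θ| := by
            rw [← hsβ, le_abs]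
            rcases le_or_gt θ (-β) with h5 | h5
            · right
              rw [← sin_neg]
              exact sin_le_sin_of_le_of_le_pi_div_two (by linarith) (by linarith) (by linarith)
            · left
              have : β < θ := by by_contra! h6; exact hm ⟨h5, h6⟩
              exact sin_le_sin_of_le_of_le_pi_div_two (by linarith) (by linarith) (by linarith)
          have h7 : (1/a)^2 ≤ sin θ^2 := by rw [← sq_abs (sin θ)]; gcongr
          have h8 : a^2 * (1/a)^2 = 1 := by field_simp
          nlinarith [sq_nonneg a]
      · rw [Real.sqrt_le_left (by positivity)]
        nlinarith [sin_sq_add_cos_sq θ]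
    · rw [if_neg h, Set.indicator_of_notMem]
      intro hm
      exact h (cos_pos_of_mem_Ioo ⟨by linarith [hm.1], by linarith [hm.2]⟩)
  rw [setIntegral_congr_fun measurableSet_Ioo this, setIntegral_indicator measurableSet_Ioc, Set.inter_eq_right.2, integral_const_mul, ← intervalIntegral.integral_of_le (by linarith)]
  swap
  · intro x hx
    exact ⟨by linarith [hx.1, pi_pos], by linarith [hx.2, pi_pos]⟩
  have hcpos : ∀ x ∈ Set.Icc (-β) β, 0 < cos x := fun x hx => cos_pos_of_mem_Ioo ⟨by linarith [hx.1], by linarith [hx.2]⟩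
  rw [intervalIntegral.integral_eq_sub_of_hasDerivAt_of_le (f := fun θ => a * arcsin (a * sin θ) - b * arcsin (b * (sin θ / cos θ)))]
  · simp only [sin_neg, cos_neg, hsβ, hcβ]
    have e1 : a * (1/a) = 1 := by field_simp
    have e2 : b * (1/a/(b/a)) = 1 := by field_simp
    have e3 : a * -(1/a) = -1 := by field_simp
    have e4 : b * (-(1/a)/(b/a)) = -1 := by field_simp
    rw [e1,e2,e3,e4]
    simp
    field_simp
    ring
  · linarith
  · apply ContinuousOn.sub
    · fun_prop
    · apply ContinuousOn.mul continuousOn_const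
      apply continuous_arcsin.comp_continuousOn
      apply ContinuousOn.mul continuousOn_const
      apply ContinuousOn.div (by fun_prop) (by fun_prop)
      intro x hx
      exact (hcpos x hx).ne'
  · intro x hx
    have hc := hcpos x ⟨hx.1.le, hx.2.le⟩
    have hsc := sin_sq_add_cos_sq x
    have hs1 : sin x < 1/a := by rw [← hsβ]; exact sin_lt_sin_of_lt_of_le_pi_div_two (by linarith [hx.1]) (by linarith) hx.2
    have hs2 : -(1/a) < sin x := by rw [← hsβ, ← sin_neg]; exact sin_lt_sin_of_lt_of_le_pi_div_two (by linarith) (by linarith [hx.2]) hx.1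
    have hlt : |a * sin x| < 1 := by
      rw [abs_mul, abs_of_pos ha0]
      have := abs_lt.2 ⟨hs2, hs1⟩
      calc a * |sin x| < a * (1/a) := by gcongr
        _ = 1 := by field_simp
    have hw : 0 < 1 - a^2 * sin x^2 := by
      have := (sq_lt_one_iff_abs_lt_one (a * sin x)).2 hlt
      nlinarith
    have hid : 1 - (b * (sin x / cos x))^2 = (1 - a^2 * sin x^2) / cos x^2 := by
      field_simp
      rw [hb2]; linear_combination hsc
    have hlt2 : |b * (sin x / cos x)| < 1 := by
      rw [← sq_lt_one_iff_abs_lt_one]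
      have : 0 < (1 - a^2 * sin x^2) / cos x^2 := by positivity
      linarith
    have d1 := (Real.hasDerivAt_arcsin (x := a * sin x) (abs_lt.1 hlt).1.ne' (abs_lt.1 hlt).2.ne).comp x ((hasDerivAt_sin x).const_mul a)
    have d2 := (Real.hasDerivAt_arcsin (x := b * (sin x / cos x)) (abs_lt.1 hlt2).1.ne' (abs_lt.1 hlt2).2.ne).comp x (((hasDerivAt_sin x).div (hasDerivAt_cos x) hc.ne').const_mul b)
    have d3 := (d1.const_mul a).sub (d2.const_mul b)
    refine d3.congr_deriv ?_
    rw [hid, Real.sqrt_div hw.le, Real.sqrt_sq hc.le]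
    have e : (1 - (a * sin x)^2) = 1 - a^2 * sin x^2 := by ring
    rw [e]
    have hW := Real.sq_sqrt hw.le
    have hW0 := Real.sqrt_pos.2 hw
    set W := √(1 - a^2 * sin x^2)
    field_simp
    rw [hW, hb2]
    linear_combination hsc
  · apply ContinuousOn.intervalIntegrable
    rw [Set.uIcc_of_le (by linarith)]
    apply ContinuousOn.div (by fun_prop) (by fun_prop)
    intro x hx
    exact (hcpos x hx).ne'

lemma exists_iso (k : EuclideanSpace ℝ (Fin 2)) (hk : k ≠ 0) :
    ∃ L : EuclideanSpace ℝ (Fin 2) ≃ₗᵢ[ℝ] ℂ, L k = (‖k‖ : ℂ) := by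
  let M := Complex.orthonormalBasisOneI.repr.symm
  have hM : ‖M k‖ = ‖k‖ := M.norm_map k
  have hk' : ‖k‖ ≠ 0 := norm_ne_zero_iff.2 hk
  have hz : M k ≠ 0 := by rw [← norm_ne_zero_iff, hM]; exact hk'
  let u : Circle := Circle.ofConjDivSelf (M k) hz
  let w : Circle := ⟨(‖k‖ : ℂ) / M k, by
    simp [Submonoid.unitSphere, hM, hk']⟩
  refine ⟨M.trans (rotation w), ?_⟩
  simp only [LinearIsometryEquiv.trans_apply, rotation_apply]
  change (‖k‖ : ℂ) / M k * M k = _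
  field_simp

lemma polar_eq {a : ℝ} (ha : 0 < a) :
    ∫ q : ℂ, Set.indicator {q : ℂ | ‖(a:ℂ) - q‖^2 ≤ 1 ∧ 1 ≤ ‖(a:ℂ) - q - 2 * a‖^2}
       (fun q => (‖(a:ℂ) - q - 2 * a‖^2 - ‖(a:ℂ) - q‖^2)⁻¹) q =
    ∫ θ in Set.Ioo (-π) π, (if 0 < cos θ then min √(1-a^2*sin θ^2) (a*cos θ) / (2*a*cos θ) else 0) := by
  rw [← Complex.integral_comp_polarCoord_symm]
  let T : Set (ℝ × ℝ) := {p | p.1^2-2*a*p.1*cos p.2+a^2≤1 ∧ 1≤ p.1^2+2*a*p.1*cos p.2+a^2}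
  let G : ℝ × ℝ → ℝ := T.indicator (fun p => (4*a*cos p.2)⁻¹)
  have hTm : MeasurableSet T := by
    exact (measurableSet_le (f := fun p : ℝ × ℝ => p.1^2-2*a*p.1*cos p.2+a^2) (g := fun _ => 1) (by fun_prop) (by fun_prop)).inter
      (measurableSet_le (f := fun _ => 1) (g := fun p : ℝ × ℝ => p.1^2+2*a*p.1*cos p.2+a^2) (by fun_prop) (by fun_prop))
  have hGm : Measurable G := Measurable.indicator (by fun_prop) hTm
  have htm : MeasurableSet polarCoord.target := polarCoord.open_target.measurableSet
  have hcongr : ∀ p ∈ polarCoord.target, p.1 • Set.indicator {q : ℂ | ‖(a:ℂ) - q‖^2 ≤ 1 ∧ 1 ≤ ‖(a:ℂ) - q - 2 * a‖^2}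
       (fun q => (‖(a:ℂ) - q - 2 * a‖^2 - ‖(a:ℂ) - q‖^2)⁻¹) (Complex.polarCoord.symm p) = G p := by
    rintro ⟨r, θ⟩ hp
    have hr : 0 < r := hp.1
    have hsc := sin_sq_add_cos_sq θ
    have e1 : ‖(a:ℂ) - Complex.polarCoord.symm (r, θ)‖^2 = r^2-2*a*r*cos θ+a^2 := by
      rw [Complex.polarCoord_symm_apply, ← Complex.normSq_eq_norm_sq, Complex.normSq_apply]
      simp [-Complex.ofReal_cos, -Complex.ofReal_sin]
      linear_combination r^2 * hsc
    have e2 : ‖(a:ℂ) - Complex.polarCoord.symm (r, θ) - 2 * a‖^2 = r^2+2*a*r*cos θ+a^2 := by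
      rw [Complex.polarCoord_symm_apply, ← Complex.normSq_eq_norm_sq, Complex.normSq_apply]
      simp [-Complex.ofReal_cos, -Complex.ofReal_sin]
      linear_combination r^2 * hsc
    simp only [G, T, Set.indicator, Set.mem_ofPred_eq, e1, e2, smul_eq_mul]
    split_ifs with h
    · have : r^2+2*a*r*cos θ+a^2 - (r^2-2*a*r*cos θ+a^2) = r * (4*a*cos θ) := by ring
      rw [this, mul_inv, mul_inv_cancel_left₀ hr.ne']
    · simp
  rw [setIntegral_congr_fun htm hcongr]
  have ht : polarCoord.target = Set.Ioi (0:ℝ) ×ˢ Set.Ioo (-π) π := rfl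
  rw [ht, Measure.volume_eq_prod, ← Measure.prod_restrict]
  have hsl := fun θ : ℝ => slice_int (a := a) (c := cos θ) (s := sin θ) ha (by linarith [sin_sq_add_cos_sq θ])
  have hsec : ∀ θ, (fun r => G (r, θ)) = Set.indicator {r : ℝ | r^2-2*a*r*cos θ+a^2≤1 ∧ 1≤ r^2+2*a*r*cos θ+a^2} (fun _ => (4*a*cos θ)⁻¹) := fun θ => rfl
  have hnn : ∀ r ∈ Set.Ioi (0:ℝ), ∀ θ, 0 ≤ G (r, θ) := by
    intro r hr θ
    simp only [G]
    apply Set.indicator_apply_nonneg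
    rintro ⟨h1, h2⟩
    have h1' : r^2-2*a*r*cos θ+a^2≤1 := h1
    have h2' : 1≤ r^2+2*a*r*cos θ+a^2 := h2
    have : 0 ≤ (a * r) * cos θ := by nlinarith
    have := nonneg_of_mul_nonneg_right this (mul_pos ha hr)
    positivity
  have hint : Integrable G ((volume.restrict (Set.Ioi 0)).prod (volume.restrict (Set.Ioo (-π) π))) := by
    rw [integrable_prod_iff' hGm.aestronglyMeasurable]
    constructor
    · filter_upwards with θ
      rw [hsec]; exact (hsl θ).1
    · have : ∀ θ, ∫ r in Set.Ioi 0, ‖G (r, θ)‖ = (if 0 < cos θ then min √(1-a^2*sin θ^2) (a*cos θ) / (2*a*cos θ) else 0) := by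
        intro θ
        rw [← (hsl θ).2, ← hsec]
        apply setIntegral_congr_fun measurableSet_Ioi
        intro r hr
        exact Real.norm_of_nonneg (hnn r hr θ)
      simp only [this]
      apply Integrable.of_bound (C := 1/2)
      · apply Measurable.aestronglyMeasurable
        apply Measurable.ite (measurableSet_lt (by fun_prop) (by fun_prop)) (by fun_prop) (by fun_prop)
      · filter_upwards with θ
        split_ifs with h
        · rw [Real.norm_of_nonneg (by positivity), div_le_iff₀ (by positivity)]
          linarith [min_le_right √(1-a^2*sin θ^2) (a*cos θ)]
        · simp
  rw [integral_prod_symm _ hint]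
  congr 1
  ext θ
  rw [hsec, (hsl θ).2]

lemma main_int (k : EuclideanSpace ℝ (Fin 2)) (hk : k ≠ 0) :
   ∫ p in {p : EuclideanSpace ℝ (Fin 2) | ‖p‖ ^ 2 ≤ 1 ∧ 1 ≤ ‖p - k‖ ^ 2},
            (‖p - k‖ ^ 2 - ‖p‖ ^ 2)⁻¹ = π/2 * (1 - Real.sqrt (max (1 - 4 / ‖k‖ ^ 2) 0)) := by
  obtain ⟨L, hL⟩ := exists_iso k hk
  obtain ⟨a, hka⟩ : ∃ a, ‖k‖ = 2 * a := ⟨‖k‖/2, by ring⟩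
  have ha : 0 < a := by have := norm_pos_iff.2 hk; linarith
  have h1 := L.measurePreserving.setIntegral_preimage_emb L.toHomeomorph.measurableEmbedding
    (fun z : ℂ => (‖z - 2 * a‖^2 - ‖z‖^2)⁻¹) {z : ℂ | ‖z‖^2 ≤ 1 ∧ 1 ≤ ‖z - 2 * a‖^2}
  have h2 : ∀ p, ‖L p - 2 * a‖ = ‖p - k‖ := by
    intro p
    rw [← L.norm_map (p - k), map_sub, hL, hka]; simp
  simp only [Set.preimage_ofPred_eq, h2, LinearIsometryEquiv.norm_map] at h1
  have hm : MeasurableSet {z : ℂ | ‖z‖^2 ≤ 1 ∧ 1 ≤ ‖z - 2 * a‖^2} :=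
    (measurableSet_le (f := fun z : ℂ => ‖z‖^2) (g := fun _ => 1) (by fun_prop) (by fun_prop)).inter
      (measurableSet_le (f := fun _ => 1) (g := fun z : ℂ => ‖z - 2 * a‖^2) (by fun_prop) (by fun_prop))
  rw [h1, ← integral_indicator hm, ← integral_sub_left_eq_self _ _ (a : ℂ)]
  have h3 := polar_eq ha
  refine Eq.trans ?_ (h3.trans ?_)
  · rfl
  · rw [hka]
    rcases le_or_gt a 1 with h | h
    · rw [theta_small ha h, max_eq_right]
      · simp
      · have : 1 ≤ 4 / (2*a)^2 := by
          rw [le_div_iff₀ (by positivity)]; nlinarith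
        linarith
    · rw [theta_large h]
      have : 1 - 4 / (2*a)^2 = (a^2-1)/a^2 := by field_simp; ring
      rw [this, max_eq_left (div_nonneg (by nlinarith) (by positivity)), Real.sqrt_div (by nlinarith), Real.sqrt_sq ha.le]

/-- the two-dimensional response function
`Ψ₂(k) = (2π)⁻² ∫_{|p|≤1, |p−k|≥1} dp/(|p−k|²−|p|²)` equals
`(1/(8π))(1 − √((1 − 4/|k|²)_+))` for all `k ≠ 0`; in particular the
closed-form expression is constant equal to `1/(8π)` for `0 < |k| ≤ 2` and
strictly decreasing in `|k|` on `[2, ∞)`. -/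
theorem Psi2_closed_form :
    (∀ k : EuclideanSpace ℝ (Fin 2), k ≠ 0 →
      ((2 * π) ^ 2)⁻¹ *
          ∫ p in {p : EuclideanSpace ℝ (Fin 2) | ‖p‖ ^ 2 ≤ 1 ∧ 1 ≤ ‖p - k‖ ^ 2},
            (‖p - k‖ ^ 2 - ‖p‖ ^ 2)⁻¹
        = (1 / (8 * π)) * (1 - Real.sqrt (max (1 - 4 / ‖k‖ ^ 2) 0))) ∧
    (∀ t ∈ Set.Ioc (0 : ℝ) 2,
      (1 / (8 * π)) * (1 - Real.sqrt (max (1 - 4 / t ^ 2) 0)) = 1 / (8 * π)) ∧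
    StrictAntiOn (fun t : ℝ => (1 / (8 * π)) * (1 - Real.sqrt (max (1 - 4 / t ^ 2) 0)))
      (Set.Ici 2) := by
  refine ⟨?_, ?_, ?_⟩
  · intro k hk
    rw [main_int k hk]
    field_simp
    ring
  · rintro t ⟨ht0, ht2⟩
    have : 1 ≤ 4 / t^2 := by
      rw [le_div_iff₀ (by positivity)]; nlinarith
    rw [max_eq_right (by linarith)]
    simp
  · intro s hs t ht hst
    have hs2 : (2:ℝ) ≤ s := hs
    have ht2 : (2:ℝ) ≤ t := ht
    have h1 : 4 / s^2 ≤ 1 := by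
      rw [div_le_one (by positivity)]; nlinarith
    have h2 : 4 / t^2 < 4 / s^2 := by gcongr
    have h3 : √(1 - 4 / s^2) < √(1 - 4 / t^2) := Real.sqrt_lt_sqrt (by linarith) (by linarith)
    simp only
    rw [max_eq_left (by linarith), max_eq_left (by linarith)]
    have : 0 < 1 / (8 * π) := by positivity
    exact mul_lt_mul_of_pos_left (by linarith) this
end
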